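/- Let k be an odd prime with k ≥ 5 and set n = k − 3. Let s = (s_1,…,s_n) and s' = (s'_1,…,s'_n) be tuples of integers such that each tuple satisfies: gcd(s_i, k) = 1 for all i; s_i ≢ s_j (mod k) for all i ≠ j; and there exists an index i such that s_i ≢ −s_j (mod k) for every j (and likewise for s'). Then d_{Γ_{k,s}}(p,q) = d_{Γ_{k,s'}}(p,q) for all p, q ≥ 0. (Equivalently, the generating functions F_{L(k;s)} and F_{L(k;s')} coincide, so the CR lens spaces L(k;s) and L(k;s') are CR isospectral.) -/

import Mathlib

open MvPolynomial Matrix Complex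

noncomputable section

/-- The polynomial ring `ℂ[z_1,…,z_n, z̄_1,…,z̄_n]`. -/
abbrev Rn (n : ℕ) := MvPolynomial (Fin n ⊕ Fin n) ℂ

/-- Weight assigning `(1,0)` to each `z_j` and `(0,1)` to each `z̄_j`. -/
def wt (n : ℕ) : (Fin n ⊕ Fin n) → ℕ × ℕ := Sum.elim (fun _ => (1, 0)) (fun _ => (0, 1))

/-- `𝒫_{p,q}`: polynomials homogeneous of degree `p` in `z` and `q` in `z̄`. -/
def Ppq (n p q : ℕ) : Submodule ℂ (Rn n) :=
  MvPolynomial.weightedHomogeneousSubmodule ℂ (wt n) (p, q)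

/-- `Δ = Σ_j ∂²/∂z_j∂z̄_j`. -/
def DeltaOp (n : ℕ) : Rn n →ₗ[ℂ] Rn n :=
  ∑ j : Fin n, (MvPolynomial.pderiv (Sum.inl j)).toLinearMap ∘ₗ (MvPolynomial.pderiv (Sum.inr j)).toLinearMap

/-- `ℋ_{p,q}`: harmonic polynomials of bidegree `(p,q)`. -/
def Hpq (n p q : ℕ) : Submodule ℂ (Rn n) :=
  Ppq n p q ⊓ LinearMap.ker (DeltaOp n)

/-- The action of a matrix `γ` on `R_n` by the algebra substitution
`z_i ↦ Σ_j (γ⁻¹)_{ij} z_j`, `z̄_i ↦ Σ_j conj((γ⁻¹)_{ij}) z̄_j`. -/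
def matAct (n : ℕ) (γ : Matrix (Fin n) (Fin n) ℂ) : Rn n →ₐ[ℂ] Rn n :=
  MvPolynomial.aeval (Sum.elim
    (fun i => ∑ j, (γ⁻¹ i j) • MvPolynomial.X (Sum.inl j))
    (fun i => ∑ j, (starRingEnd ℂ) (γ⁻¹ i j) • MvPolynomial.X (Sum.inr j)))

/-- The subspace of polynomials fixed by the action of `γ`. -/
def fixedBy (n : ℕ) (γ : Matrix (Fin n) (Fin n) ℂ) : Submodule ℂ (Rn n) :=
  LinearMap.ker ((matAct n γ).toLinearMap - LinearMap.id)

/-- `ℋ_{p,q}^Γ`, the `Γ`-invariant harmonic polynomials of bidegree `(p,q)`. -/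
def HpqInv (n p q : ℕ) (Γ : Subgroup (Matrix.unitaryGroup (Fin n) ℂ)) : Submodule ℂ (Rn n) :=
  Hpq n p q ⊓ ⨅ γ ∈ Γ, fixedBy n ↑γ

/-- `d_Γ(p,q) = dim_ℂ ℋ_{p,q}^Γ`. -/
def dInv (n p q : ℕ) (Γ : Subgroup (Matrix.unitaryGroup (Fin n) ℂ)) : ℕ :=
  Module.finrank ℂ (HpqInv n p q Γ)

/-- A subgroup of `U(n)` acts freely on `S^{2n-1}` iff no nontrivial element has `1` as an
eigenvalue. -/
def actsFreely (n : ℕ) (Γ : Subgroup (Matrix.unitaryGroup (Fin n) ℂ)) : Prop :=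
  ∀ γ ∈ Γ, γ ≠ 1 → ∀ v : Fin n → ℂ, (↑γ : Matrix (Fin n) (Fin n) ℂ).mulVec v = v → v = 0
/-- The standard primitive `k`-th root of unity `ξ_k = exp(2πi/k)`. -/
def xi (k : ℕ) : ℂ := Complex.exp (2 * Real.pi * Complex.I / k)

lemma xi_ne_zero (k : ℕ) : xi k ≠ 0 := Complex.exp_ne_zero _

lemma star_xi (k : ℕ) : (starRingEnd ℂ) (xi k) = (xi k)⁻¹ := by
  rw [xi, ← Complex.exp_conj, ← Complex.exp_neg]
  congr 1
  rw [map_div₀, _root_.map_mul, _root_.map_mul, Complex.conj_I]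
  simp [Complex.conj_ofReal, map_ofNat]
  ring

/-- The generator `γ_{k,s} = diag(ξ_k^{s_1}, …, ξ_k^{s_n})` of a lens group. -/
def lensGen (n : ℕ) (k : ℕ) (s : Fin n → ℤ) : Matrix (Fin n) (Fin n) ℂ :=
  Matrix.diagonal fun i => xi k ^ (s i)

lemma lensGen_mem (n k : ℕ) (s : Fin n → ℤ) :
    lensGen n k s ∈ Matrix.unitaryGroup (Fin n) ℂ := by
  rw [Matrix.mem_unitaryGroup_iff]
  have hstar : star (lensGen n k s) = Matrix.diagonal fun i => star (xi k ^ (s i)) := by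
    rw [lensGen, Matrix.star_eq_conjTranspose, Matrix.diagonal_conjTranspose]
    rfl
  rw [hstar, lensGen, Matrix.diagonal_mul_diagonal]
  convert Matrix.diagonal_one
  rename_i i
  have : (starRingEnd ℂ) (xi k ^ (s i)) = (xi k ^ (s i))⁻¹ := by
    rw [map_zpow₀, star_xi, _root_.inv_zpow]
  rw [RCLike.star_def, this, mul_inv_cancel₀ (zpow_ne_zero _ (xi_ne_zero k))]

/-- The cyclic subgroup `Γ_{k,s}` of `U(n)` generated by `γ_{k,s}`. -/
def lensSubgroup (n k : ℕ) (s : Fin n → ℤ) : Subgroup (Matrix.unitaryGroup (Fin n) ℂ) :=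
  Subgroup.zpowers ⟨lensGen n k s, lensGen_mem n k s⟩

/-- The number of exponent vectors `(α, β)` with `|α| = p`, `|β| = q` on which the weight
`∑ t_i (α_i - β_i)` vanishes. -/
def balancedCount {n k : ℕ} (t : Fin n → ZMod k) (p q : ℕ) : ℕ :=
  (((Finset.univ : Finset (Fin n)).finsuppAntidiag p ×ˢ
    (Finset.univ : Finset (Fin n)).finsuppAntidiag q).filter
      fun ab => ∑ i, t i * ((ab.1 i : ZMod k) - (ab.2 i : ZMod k)) = 0).card

/-- The generating function `∏ᵢ 1 / (1 - xᵢ X)` of complete homogeneous symmetric polynomials. -/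
def geomProd {n : ℕ} (x : Fin n → ℂ) : PowerSeries ℂ :=
  ∏ i, PowerSeries.mk fun m => x i ^ m

lemma mk_pow_mul_one_sub (x : ℂ) :
    (PowerSeries.mk fun m => x ^ m) * (1 - PowerSeries.C x * PowerSeries.X) = 1 := by
  ext m
  cases m with
  | zero => simp [mul_sub]
  | succ m =>
    rw [mul_sub, mul_one, mul_left_comm, map_sub, PowerSeries.coeff_C_mul,
      PowerSeries.coeff_succ_mul_X]
    simp [PowerSeries.coeff_one, pow_succ']

lemma geomProd_mul_prod {n : ℕ} (x : Fin n → ℂ) :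
    geomProd x * ∏ i, (1 - PowerSeries.C (x i) * PowerSeries.X) = 1 := by
  rw [geomProd, ← Finset.prod_mul_distrib]
  exact Finset.prod_eq_one fun i _ => mk_pow_mul_one_sub _

lemma coeff_geomProd {n : ℕ} (x : Fin n → ℂ) (p : ℕ) :
    PowerSeries.coeff p (geomProd x) =
      ∑ a ∈ (Finset.univ : Finset (Fin n)).finsuppAntidiag p, ∏ i, x i ^ a i := by
  simp [geomProd, PowerSeries.coeff_prod]

section Characters

lemma stdAddChar_sum {ι : Type*} {k : ℕ} [NeZero k] (u : Finset ι) (f : ι → ZMod k) :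
    (ZMod.stdAddChar (∑ i ∈ u, f i) : ℂ) = ∏ i ∈ u, ZMod.stdAddChar (f i) := by
  induction u using Finset.cons_induction with
  | empty => simp
  | cons i u hi ih => rw [Finset.sum_cons, Finset.prod_cons, AddChar.map_add_eq_mul, ih]

variable {k : ℕ} [Fact k.Prime]

lemma stdAddChar_mul_natCast (t l : ZMod k) (m : ℕ) :
    ZMod.stdAddChar (l * (t * (m : ZMod k))) = ZMod.stdAddChar (l * t) ^ m := by
  rw [← AddChar.map_nsmul_eq_pow, nsmul_eq_mul]
  congr 1
  ring

lemma natCast_mul_balancedCount {n : ℕ} (t : Fin n → ZMod k) (p q : ℕ) :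
    (k : ℂ) * balancedCount t p q =
      ∑ l : ZMod k, PowerSeries.coeff p (geomProd fun i => ZMod.stdAddChar (l * t i)) *
        PowerSeries.coeff q (geomProd fun i => ZMod.stdAddChar (-l * t i)) := by
  simp_rw [coeff_geomProd, Finset.sum_mul_sum, ← Finset.sum_product']
  rw [Finset.sum_product_right, balancedCount, Finset.card_filter, Nat.cast_sum, Finset.mul_sum]
  refine Finset.sum_congr rfl fun ab _ => ?_
  have h := AddChar.sum_mulShift (∑ i, t i * ((ab.1 i : ZMod k) - (ab.2 i : ZMod k)))
    (ZMod.isPrimitive_stdAddChar k)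
  rw [ZMod.card] at h
  push_cast at h
  transitivity (if ∑ i, t i * ((ab.1 i : ZMod k) - (ab.2 i : ZMod k)) = 0 then (k : ℂ) else 0)
  · split_ifs <;> simp
  · refine h.symm.trans (Finset.sum_congr rfl fun l _ => ?_)
    rw [← Finset.prod_mul_distrib, Finset.mul_sum, stdAddChar_sum]
    refine Finset.prod_congr rfl fun i _ => ?_
    rw [← stdAddChar_mul_natCast, ← stdAddChar_mul_natCast, ← AddChar.map_add_eq_mul]
    congr 1
    ring

lemma prod_one_sub_stdAddChar {l : ZMod k} (hl : l ≠ 0) :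
    ∏ t : ZMod k, (1 - PowerSeries.C (ZMod.stdAddChar (l * t)) * PowerSeries.X) =
      1 - (PowerSeries.X : PowerSeries ℂ) ^ k := by
  classical
  have hk : 0 < k := (Fact.out : k.Prime).pos
  have hinj : Function.Injective
      fun t : ZMod k => PowerSeries.C (R := ℂ) (ZMod.stdAddChar (l * t)) := fun a b h =>
    mul_left_cancel₀ hl (ZMod.injective_stdAddChar (PowerSeries.C_injective h))
  have hprim : IsPrimitiveRoot
      (PowerSeries.C (R := ℂ) (Complex.exp (2 * Real.pi * Complex.I / k))) k :=
    (Complex.isPrimitiveRoot_exp k hk.ne').map_of_injective PowerSeries.C_injective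
  have himage : Finset.univ.image
      (fun t : ZMod k => PowerSeries.C (R := ℂ) (ZMod.stdAddChar (l * t))) =
        Polynomial.nthRootsFinset k (1 : PowerSeries ℂ) := by
    apply Finset.eq_of_subset_of_card_le
    · intro x hx
      obtain ⟨t, -, rfl⟩ := Finset.mem_image.1 hx
      rw [Polynomial.mem_nthRootsFinset hk, ← map_pow, ← AddChar.map_nsmul_eq_pow]
      simp
    · rw [hprim.card_nthRootsFinset, Finset.card_image_of_injective _ hinj, Finset.card_univ,
        ZMod.card]
  have h := hprim.pow_sub_pow_eq_prod_sub_mul 1 PowerSeries.X hk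
  rw [← himage, Finset.prod_image fun a _ b _ hab => hinj hab, one_pow] at h
  exact h.symm

/-- `(1 - X) / (1 - X^k)` as a power series. -/
def oneSubDiv (k : ℕ) : PowerSeries ℂ :=
  (1 - PowerSeries.X) * (1 - PowerSeries.X ^ k)⁻¹

lemma geomProd_eq_of_compl {n : ℕ} {t : Fin n → ZMod k} (ht : Function.Injective t)
    (h0 : ∀ i, t i ≠ 0) {a b : ZMod k} (hab : a ≠ b)
    (hcompl : (Finset.univ.image t ∪ {0})ᶜ = {a, b}) {l : ZMod k} (hl : l ≠ 0) :
    geomProd (fun i => ZMod.stdAddChar (l * t i)) =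
      oneSubDiv k * ((1 - PowerSeries.C (ZMod.stdAddChar (l * a)) * PowerSeries.X) *
        (1 - PowerSeries.C (ZMod.stdAddChar (l * b)) * PowerSeries.X)) := by
  have hk : k ≠ 0 := (Fact.out : k.Prime).ne_zero
  set f : ZMod k → PowerSeries ℂ :=
    fun t => 1 - PowerSeries.C (ZMod.stdAddChar (l * t)) * PowerSeries.X with hf
  have hsplit : (∏ i, f (t i)) * (1 - PowerSeries.X) * (f a * f b) = 1 - PowerSeries.X ^ k := by
    rw [← prod_one_sub_stdAddChar hl, ← Finset.prod_mul_prod_compl (Finset.univ.image t ∪ {0}),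
      hcompl, Finset.prod_pair hab, Finset.prod_union, Finset.prod_image fun a _ b _ h => ht h]
    · simp [hf]
    · simpa using h0
  have hunit : (1 - PowerSeries.X ^ k : PowerSeries ℂ) * (1 - PowerSeries.X ^ k)⁻¹ = 1 :=
    PowerSeries.mul_inv_cancel _ (by simp [hk])
  have hgeom := geomProd_mul_prod fun i => ZMod.stdAddChar (l * t i)
  change geomProd _ * ∏ i, f (t i) = 1 at hgeom
  rw [oneSubDiv]
  change _ = _ * (f a * f b)
  linear_combination (-(geomProd fun i => (ZMod.stdAddChar (l * t i) : ℂ))) * hunit +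
    (1 - PowerSeries.X ^ k)⁻¹ * (1 - PowerSeries.X) * f a * f b * hgeom -
    (geomProd fun i => (ZMod.stdAddChar (l * t i) : ℂ)) * (1 - PowerSeries.X ^ k)⁻¹ * hsplit

lemma coeff_geomProd_of_compl {n : ℕ} {t : Fin n → ZMod k} (ht : Function.Injective t)
    (h0 : ∀ i, t i ≠ 0) {a b : ZMod k} (hab : a ≠ b)
    (hcompl : (Finset.univ.image t ∪ {0})ᶜ = {a, b}) {l : ZMod k} (hl : l ≠ 0) (p : ℕ) :
    PowerSeries.coeff p (geomProd fun i => ZMod.stdAddChar (l * t i)) =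
      PowerSeries.coeff p (oneSubDiv k) -
        (ZMod.stdAddChar (l * a) + ZMod.stdAddChar (l * b)) *
          PowerSeries.coeff p (oneSubDiv k * PowerSeries.X) +
        ZMod.stdAddChar (l * (a + b)) *
          PowerSeries.coeff p (oneSubDiv k * PowerSeries.X ^ 2) := by
  rw [geomProd_eq_of_compl ht h0 hab hcompl hl, mul_add l, AddChar.map_add_eq_mul,
    ← PowerSeries.coeff_C_mul, ← PowerSeries.coeff_C_mul, ← map_sub, ← map_add]
  congr 1
  simp only [map_add, map_mul]
  ring

lemma sum_ne_zero_stdAddChar {t : ZMod k} (ht : t ≠ 0) :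
    ∑ l ∈ Finset.univ.erase (0 : ZMod k), (ZMod.stdAddChar (l * t) : ℂ) = -1 := by
  have h := AddChar.sum_mulShift t (ZMod.isPrimitive_stdAddChar k)
  rw [if_neg ht, ← Finset.add_sum_erase _ _ (Finset.mem_univ (0 : ZMod k))] at h
  simp only [zero_mul, AddChar.map_zero_eq_one, Nat.cast_zero] at h
  linear_combination h

lemma natCast_mul_balancedCount_of_compl {n : ℕ} {t : Fin n → ZMod k}
    (ht : Function.Injective t) (h0 : ∀ i, t i ≠ 0) {a b : ZMod k} (hab : a ≠ b)
    (ha : a ≠ 0) (hb : b ≠ 0) (hadd : a + b ≠ 0)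
    (hcompl : (Finset.univ.image t ∪ {0})ᶜ = {a, b}) (p q : ℕ) :
    (k : ℂ) * balancedCount t p q =
      PowerSeries.coeff p (geomProd fun _ : Fin n => 1) *
          PowerSeries.coeff q (geomProd fun _ : Fin n => 1) +
        ((k - 1) * PowerSeries.coeff p (oneSubDiv k) * PowerSeries.coeff q (oneSubDiv k)
        + 2 * PowerSeries.coeff p (oneSubDiv k) *
            PowerSeries.coeff q (oneSubDiv k * PowerSeries.X)
        - PowerSeries.coeff p (oneSubDiv k) *
            PowerSeries.coeff q (oneSubDiv k * PowerSeries.X ^ 2)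
        + 2 * PowerSeries.coeff p (oneSubDiv k * PowerSeries.X) *
            PowerSeries.coeff q (oneSubDiv k)
        + (2 * (k - 1) - 2) * PowerSeries.coeff p (oneSubDiv k * PowerSeries.X) *
            PowerSeries.coeff q (oneSubDiv k * PowerSeries.X)
        + 2 * PowerSeries.coeff p (oneSubDiv k * PowerSeries.X) *
            PowerSeries.coeff q (oneSubDiv k * PowerSeries.X ^ 2)
        - PowerSeries.coeff p (oneSubDiv k * PowerSeries.X ^ 2) *
            PowerSeries.coeff q (oneSubDiv k)
        + 2 * PowerSeries.coeff p (oneSubDiv k * PowerSeries.X ^ 2) *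
            PowerSeries.coeff q (oneSubDiv k * PowerSeries.X)
        + (k - 1) * PowerSeries.coeff p (oneSubDiv k * PowerSeries.X ^ 2) *
            PowerSeries.coeff q (oneSubDiv k * PowerSeries.X ^ 2)) := by
  rw [natCast_mul_balancedCount, ← Finset.add_sum_erase _ _ (Finset.mem_univ (0 : ZMod k))]
  congr 1
  · simp
  generalize hu : PowerSeries.coeff p (oneSubDiv k) = u0
  generalize hu1 : PowerSeries.coeff p (oneSubDiv k * PowerSeries.X) = u1
  generalize hu2 : PowerSeries.coeff p (oneSubDiv k * PowerSeries.X ^ 2) = u2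
  generalize hv : PowerSeries.coeff q (oneSubDiv k) = v0
  generalize hv1 : PowerSeries.coeff q (oneSubDiv k * PowerSeries.X) = v1
  generalize hv2 : PowerSeries.coeff q (oneSubDiv k * PowerSeries.X ^ 2) = v2
  have hone : ∑ l ∈ Finset.univ.erase (0 : ZMod k), (1 : ℂ) = k - 1 := by
    rw [Finset.sum_const, Finset.card_erase_of_mem (Finset.mem_univ _), Finset.card_univ,
      ZMod.card, nsmul_eq_mul, mul_one, Nat.cast_pred (Fact.out : k.Prime).pos]
  set e : ZMod k → ZMod k → ℂ := fun t l => ZMod.stdAddChar (l * t) with he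
  have hsum : ∀ t, t ≠ 0 → ∑ l ∈ Finset.univ.erase (0 : ZMod k), e t l = -1 :=
    fun t => sum_ne_zero_stdAddChar
  have hexpand : ∀ l ∈ Finset.univ.erase (0 : ZMod k),
      PowerSeries.coeff p (geomProd fun i => ZMod.stdAddChar (l * t i)) *
        PowerSeries.coeff q (geomProd fun i => ZMod.stdAddChar (-l * t i)) =
      (u0 * v0 + 2 * u1 * v1 + u2 * v2) * 1
      - u0 * v1 * e (-a) l - u0 * v1 * e (-b) l + u0 * v2 * e (-(a + b)) l
      - u1 * v0 * e a l - u1 * v0 * e b l + u2 * v0 * e (a + b) l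
      + u1 * v1 * e (a - b) l + u1 * v1 * e (b - a) l
      - u1 * v2 * e (-a) l - u1 * v2 * e (-b) l
      - u2 * v1 * e a l - u2 * v1 * e b l := by
    intro l hl
    have hl0 := (Finset.mem_erase.1 hl).1
    rw [coeff_geomProd_of_compl ht h0 hab hcompl hl0,
      coeff_geomProd_of_compl ht h0 hab hcompl (neg_ne_zero.2 hl0), hu, hu1, hu2, hv, hv1, hv2]
    have hinv : ∀ t, e t l * e (-t) l = 1 := fun t => by
      simp only [he]
      rw [← AddChar.map_add_eq_mul]
      simp
    have hadd : ∀ t t', e (t + t') l = e t l * e t' l := fun t t' => by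
      simp only [he]
      rw [← AddChar.map_add_eq_mul, mul_add]
    have hneg : ∀ t, (ZMod.stdAddChar (-l * t) : ℂ) = e (-t) l := fun t => by
      simp [he]
    rw [hneg, hneg, hneg]
    change (u0 - (e a l + e b l) * u1 + e (a + b) l * u2) * _ = _
    rw [sub_eq_add_neg a b, sub_eq_add_neg b a, neg_add a b, hadd a b, hadd (-a) (-b), hadd a (-b),
      hadd b (-a)]
    have ha := hinv a
    have hb := hinv b
    generalize e a l = A at *
    generalize e b l = B at *
    generalize e (-a) l = A' at *
    generalize e (-b) l = B' at *
    linear_combination (u1 * v1 - u1 * v2 * B' - u2 * v1 * B + u2 * v2 * B * B') * ha +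
      (u1 * v1 - u1 * v2 * A' - u2 * v1 * A + u2 * v2) * hb
  rw [Finset.sum_congr rfl hexpand]
  simp only [Finset.sum_add_distrib, Finset.sum_sub_distrib, ← Finset.mul_sum]
  rw [hone, hsum _ ha, hsum _ hb, hsum _ hadd, hsum _ (neg_ne_zero.2 ha),
    hsum _ (neg_ne_zero.2 hb), hsum _ (neg_ne_zero.2 hadd), hsum _ (sub_ne_zero.2 hab),
    hsum _ (sub_ne_zero.2 hab.symm)]
  ring

/-- The complement of the residues of a tuple in the Ikeda family consists of zero and two
residues that are neither equal nor opposite. -/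
lemma exists_compl_eq_pair (hk3 : 3 ≤ k) {t : Fin (k - 3) → ZMod k}
    (ht : Function.Injective t) (h0 : ∀ i, t i ≠ 0) (hneg : ∃ i, ∀ j, t i + t j ≠ 0) :
    ∃ a b : ZMod k, a ≠ b ∧ a ≠ 0 ∧ b ≠ 0 ∧ a + b ≠ 0 ∧
      (Finset.univ.image t ∪ {0})ᶜ = {a, b} := by
  have hcard : ((Finset.univ.image t ∪ {0})ᶜ).card = 2 := by
    rw [Finset.card_compl, Finset.card_union_of_disjoint (by simpa using h0),
      Finset.card_image_of_injective _ ht, ZMod.card, Finset.card_univ, Fintype.card_fin,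
      Finset.card_singleton]
    omega
  obtain ⟨a, b, hab, h⟩ := Finset.card_eq_two.1 hcard
  have hmem : ∀ x, (x = a ∨ x = b) ↔ (∀ i, t i ≠ x) ∧ x ≠ 0 := fun x => by
    have := congrArg (x ∈ ·) h
    simpa [not_or, eq_comm, and_comm] using this.symm
  have ha := (hmem a).1 (Or.inl rfl)
  have hb := (hmem b).1 (Or.inr rfl)
  refine ⟨a, b, hab, ha.2, hb.2, fun hadd => ?_, h⟩
  obtain ⟨i, hi⟩ := hneg
  rcases (hmem (-t i)).2 ⟨fun j hj => hi j (by rw [hj]; ring), neg_ne_zero.2 (h0 i)⟩ with hx | hx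
  · exact hb.1 i (by linear_combination -hx - hadd)
  · exact ha.1 i (by linear_combination -hx - hadd)

theorem balancedCount_eq (hk3 : 3 ≤ k) {t t' : Fin (k - 3) → ZMod k}
    (ht : Function.Injective t) (h0 : ∀ i, t i ≠ 0) (hneg : ∃ i, ∀ j, t i + t j ≠ 0)
    (ht' : Function.Injective t') (h0' : ∀ i, t' i ≠ 0) (hneg' : ∃ i, ∀ j, t' i + t' j ≠ 0)
    (p q : ℕ) : balancedCount t p q = balancedCount t' p q := by
  obtain ⟨a, b, hab, ha, hb, hadd, h⟩ := exists_compl_eq_pair hk3 ht h0 hneg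
  obtain ⟨a', b', hab', ha', hb', hadd', h'⟩ := exists_compl_eq_pair hk3 ht' h0' hneg'
  have hk : (k : ℂ) ≠ 0 := Nat.cast_ne_zero.2 (Fact.out : k.Prime).ne_zero
  have heq := (natCast_mul_balancedCount_of_compl ht h0 hab ha hb hadd h p q).trans
    (natCast_mul_balancedCount_of_compl ht' h0' hab' ha' hb' hadd' h' p q).symm
  exact_mod_cast mul_left_cancel₀ hk heq

end Characters
/-- Bihomogeneous exponents of bidegree `(p, q)` on which the weight `∑ t_i (α_i - β_i)`
vanishes. -/
def balancedExponents {n k : ℕ} (t : Fin n → ZMod k) (p q : ℕ) : Set (Fin n ⊕ Fin n →₀ ℕ) :=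
  {m | ∑ i, m (Sum.inl i) = p ∧ ∑ i, m (Sum.inr i) = q ∧
    ∑ i, t i * ((m (Sum.inl i) : ZMod k) - (m (Sum.inr i) : ZMod k)) = 0}

section Exponents

variable {n k : ℕ} (t : Fin n → ZMod k) (p q : ℕ)

lemma balancedExponents_eq_image : balancedExponents t p q =
    Finsupp.sumFinsuppEquivProdFinsupp.symm ''
      ((((Finset.univ : Finset (Fin n)).finsuppAntidiag p ×ˢ
        (Finset.univ : Finset (Fin n)).finsuppAntidiag q).filter
          fun ab => ∑ i, t i * ((ab.1 i : ZMod k) - (ab.2 i : ZMod k)) = 0 :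
        Finset ((Fin n →₀ ℕ) × (Fin n →₀ ℕ))) : Set ((Fin n →₀ ℕ) × (Fin n →₀ ℕ))) := by
  ext m
  rw [Equiv.image_eq_preimage_symm]
  simp [balancedExponents, and_assoc, Finsupp.comapDomain_apply]
  rfl

lemma finite_balancedExponents : (balancedExponents t p q).Finite := by
  rw [balancedExponents_eq_image]
  exact (Finset.finite_toSet _).image _

lemma ncard_balancedExponents : (balancedExponents t p q).ncard = balancedCount t p q := by
  rw [balancedExponents_eq_image, Set.ncard_image_of_injective _ (Equiv.injective _),
    Set.ncard_coe_finset, balancedCount]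

instance : Module.Finite ℂ (restrictSupport ℂ (balancedExponents t p q)) :=
  haveI := (finite_balancedExponents t p q).to_subtype
  Module.Finite.of_basis (basisRestrictSupport ℂ (balancedExponents t p q))

lemma finrank_restrictSupport_balancedExponents :
    Module.finrank ℂ (restrictSupport ℂ (balancedExponents t p q)) = balancedCount t p q := by
  rw [Module.finrank_eq_nat_card_basis (basisRestrictSupport ℂ (balancedExponents t p q)),
    Nat.card_coe_set_eq, ncard_balancedExponents]

variable {t p q}

lemma add_single_mem_balancedExponents_iff {m : Fin n ⊕ Fin n →₀ ℕ} (j : Fin n) :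
    m + Finsupp.single (Sum.inl j) 1 + Finsupp.single (Sum.inr j) 1 ∈
      balancedExponents t (p + 1) (q + 1) ↔ m ∈ balancedExponents t p q := by
  classical
  simp [balancedExponents, Finsupp.single_apply, Finset.sum_add_distrib, add_sub_add_right_eq_sub]

lemma sub_single_add_single {m : Fin n ⊕ Fin n →₀ ℕ} {j : Fin n} (hl : m (Sum.inl j) ≠ 0)
    (hr : m (Sum.inr j) ≠ 0) :
    m - Finsupp.single (Sum.inr j) 1 - Finsupp.single (Sum.inl j) 1 +
      Finsupp.single (Sum.inl j) 1 + Finsupp.single (Sum.inr j) 1 = m := by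
  classical
  ext (i | i) <;> by_cases h : j = i <;> simp [h]
  · subst h; omega
  · subst h; omega

lemma sub_single_mem_balancedExponents {m : Fin n ⊕ Fin n →₀ ℕ} {j : Fin n}
    (hm : m ∈ balancedExponents t (p + 1) (q + 1)) (hl : m (Sum.inl j) ≠ 0)
    (hr : m (Sum.inr j) ≠ 0) :
    m - Finsupp.single (Sum.inr j) 1 - Finsupp.single (Sum.inl j) 1 ∈ balancedExponents t p q := by
  rwa [← add_single_mem_balancedExponents_iff j, sub_single_add_single hl hr]

end Exponents

section Laplacian

variable {n k : ℕ} {t : Fin n → ZMod k} {p q : ℕ}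

lemma DeltaOp_monomial (m : Fin n ⊕ Fin n →₀ ℕ) (c : ℂ) :
    DeltaOp n (monomial m c) = ∑ j,
      monomial (m - Finsupp.single (Sum.inr j) 1 - Finsupp.single (Sum.inl j) 1)
        (c * m (Sum.inr j) * m (Sum.inl j)) := by
  simp [DeltaOp, pderiv_monomial]

lemma DeltaOp_eq_zero {P : Rn n} (hP : P ∈ restrictSupport ℂ (balancedExponents t p q))
    (hpq : p = 0 ∨ q = 0) : DeltaOp n P = 0 := by
  rw [P.as_sum, map_sum]
  refine Finset.sum_eq_zero fun m hm => ?_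
  obtain ⟨hl, hr, -⟩ := (mem_restrictSupport_iff ℂ).1 hP hm
  rw [DeltaOp_monomial]
  refine Finset.sum_eq_zero fun j _ => ?_
  rcases hpq with rfl | rfl
  · simp [Finset.sum_eq_zero_iff.1 hl j (Finset.mem_univ j)]
  · simp [Finset.sum_eq_zero_iff.1 hr j (Finset.mem_univ j)]

lemma map_DeltaOp_le :
    (restrictSupport ℂ (balancedExponents t (p + 1) (q + 1))).map (DeltaOp n) ≤
      restrictSupport ℂ (balancedExponents t p q) := by
  rw [restrictSupport_eq_span, Submodule.map_span, Submodule.span_le]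
  rintro _ ⟨_, ⟨m, hm, rfl⟩, rfl⟩
  rw [DeltaOp_monomial]
  refine Submodule.sum_mem _ fun j _ => (monomial_mem_restrictSupport ℂ).2 ?_
  by_cases hl : m (Sum.inl j) = 0
  · simp [hl]
  by_cases hr : m (Sum.inr j) = 0
  · simp [hr]
  exact Or.inl (sub_single_mem_balancedExponents hm hl hr)

/-- Induction on the degree of `m` in the variables other than the chosen `z_i`: the leading
term of `Δ (z_i z̄_i m)` is a nonzero multiple of `m`. -/
lemma monomial_mem_map_DeltaOp (i : Fin n) {m : Fin n ⊕ Fin n →₀ ℕ}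
    (hm : m ∈ balancedExponents t p q) :
    monomial m 1 ∈
      (restrictSupport ℂ (balancedExponents t (p + 1) (q + 1))).map (DeltaOp n) := by
  induction hd : p - m (Sum.inl i) using Nat.strong_induction_on generalizing m with
  | _ d ih =>
  set M := m + Finsupp.single (Sum.inl i) 1 + Finsupp.single (Sum.inr i) 1 with hM
  have hMmem : M ∈ balancedExponents t (p + 1) (q + 1) :=
    (add_single_mem_balancedExponents_iff i).2 hm
  have hΔ : DeltaOp n (monomial M 1) ∈
      (restrictSupport ℂ (balancedExponents t (p + 1) (q + 1))).map (DeltaOp n) :=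
    Submodule.mem_map_of_mem ((monomial_mem_restrictSupport ℂ).2 (Or.inl hMmem))
  rw [DeltaOp_monomial, ← Finset.add_sum_erase _ _ (Finset.mem_univ i)] at hΔ
  have hsub : M - Finsupp.single (Sum.inr i) 1 - Finsupp.single (Sum.inl i) 1 = m := by
    rw [hM, add_tsub_cancel_right, add_tsub_cancel_right]
  have hrest := (Submodule.add_mem_iff_left _ (Submodule.sum_mem _ fun j hj => ?_)).1 hΔ
  · rw [hsub, ← mul_one (1 * _ * _ : ℂ), ← smul_eq_mul, ← smul_monomial] at hrest
    refine (Submodule.smul_mem_iff _ ?_).1 hrest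
    simp [hM, Nat.cast_add_one_ne_zero]
  · have hij : j ≠ i := (Finset.mem_erase.1 hj).1
    by_cases hl : M (Sum.inl j) = 0
    · simp [hl]
    by_cases hr : M (Sum.inr j) = 0
    · simp [hr]
    have hmem := sub_single_mem_balancedExponents hMmem hl hr
    rw [← mul_one (1 * _ * _ : ℂ), ← smul_eq_mul, ← smul_monomial]
    refine Submodule.smul_mem _ _ (ih _ ?_ hmem rfl)
    have hle := Finset.single_le_sum (fun _ _ => Nat.zero_le _) (Finset.mem_univ i)
      |>.trans_eq hmem.1
    have hval : (M - Finsupp.single (Sum.inr j) 1 - Finsupp.single (Sum.inl j) 1 : Fin n ⊕ Fin n →₀ ℕ)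
        (Sum.inl i) =
        m (Sum.inl i) + 1 := by
      simp [hM, hij]
    rw [hval] at hle ⊢
    omega

lemma map_DeltaOp (hn : 0 < n) :
    (restrictSupport ℂ (balancedExponents t (p + 1) (q + 1))).map (DeltaOp n) =
      restrictSupport ℂ (balancedExponents t p q) := by
  refine le_antisymm map_DeltaOp_le ?_
  rw [restrictSupport_eq_span ℂ (balancedExponents t p q), Submodule.span_le]
  rintro _ ⟨m, hm, rfl⟩
  exact monomial_mem_map_DeltaOp ⟨0, hn⟩ hm

lemma finrank_harmonic_of_eq_zero (hpq : p = 0 ∨ q = 0) :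
    Module.finrank ℂ ↥(restrictSupport ℂ (balancedExponents t p q) ⊓ LinearMap.ker (DeltaOp n)) =
      balancedCount t p q := by
  rw [inf_eq_left.2 fun P hP => DeltaOp_eq_zero hP hpq, finrank_restrictSupport_balancedExponents]

lemma finrank_harmonic_succ (hn : 0 < n) :
    Module.finrank ℂ ↥(restrictSupport ℂ (balancedExponents t (p + 1) (q + 1)) ⊓
        LinearMap.ker (DeltaOp n)) + balancedCount t p q =
      balancedCount t (p + 1) (q + 1) := by
  set V := restrictSupport ℂ (balancedExponents t (p + 1) (q + 1)) with hV
  have h := ((DeltaOp n).domRestrict V).finrank_range_add_finrank_ker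
  have hker : (LinearMap.ker ((DeltaOp n).domRestrict V)).map V.subtype =
      V ⊓ LinearMap.ker (DeltaOp n) := by
    rw [LinearMap.ker_domRestrict, ← Submodule.map_comap_subtype]
  rw [LinearMap.range_domRestrict, map_DeltaOp hn, finrank_restrictSupport_balancedExponents,
    finrank_restrictSupport_balancedExponents,
    ← Submodule.finrank_map_subtype_eq, hker] at h
  exact (add_comm _ _).trans h

end Laplacian

section Invariants

variable {n k : ℕ}

lemma weight_wt (m : Fin n ⊕ Fin n →₀ ℕ) :
    Finsupp.weight (wt n) m = (∑ i, m (Sum.inl i), ∑ i, m (Sum.inr i)) := by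
  rw [Finsupp.weight_apply, Finsupp.sum_fintype _ _ (by simp), Fintype.sum_sum_type]
  simp [wt, Prod.ext_iff, Prod.fst_sum, Prod.snd_sum]

lemma coeff_matAct_diagonal {d : Fin n → ℂ} (hd : ∀ i, d i ≠ 0) (P : Rn n)
    (m : Fin n ⊕ Fin n →₀ ℕ) :
    coeff m (matAct n (diagonal d) P) =
      (∏ i, ((d i)⁻¹ ^ m (Sum.inl i) * (starRingEnd ℂ) (d i)⁻¹ ^ m (Sum.inr i))) * coeff m P := by
  have hinv : (diagonal d)⁻¹ = diagonal fun i => (d i)⁻¹ := by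
    refine Matrix.inv_eq_right_inv ?_
    rw [diagonal_mul_diagonal, ← diagonal_one]
    congr 1
    funext i
    exact mul_inv_cancel₀ (hd i)
  induction P using MvPolynomial.induction_on' with
  | add P Q hP hQ => rw [map_add, coeff_add, hP, hQ, coeff_add, mul_add]
  | monomial m' c =>
    have hact : matAct n (diagonal d) (monomial m' c) = monomial m'
        ((∏ i, ((d i)⁻¹ ^ m' (Sum.inl i) * (starRingEnd ℂ) (d i)⁻¹ ^ m' (Sum.inr i))) * c) := by
      rw [matAct, hinv, aeval_monomial, Finsupp.prod_fintype _ _ (by simp), monomial_eq (a := _ * c),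
        Finsupp.prod_fintype _ _ (by simp), Fintype.prod_sum_type, Fintype.prod_sum_type]
      simp only [Sum.elim_inl, Sum.elim_inr, diagonal_apply, apply_ite (starRingEnd ℂ), map_zero,
        ite_smul, zero_smul, Finset.sum_ite_eq, Finset.mem_univ, if_true, smul_eq_C_mul, mul_pow,
        Finset.prod_mul_distrib, map_mul, map_prod, map_pow, algebraMap_eq]
      ring
    classical
    rw [hact, coeff_monomial, coeff_monomial]
    split_ifs with h
    · rw [h]
    · rw [mul_zero]

lemma xi_zpow [NeZero k] (j : ℤ) : xi k ^ j = ZMod.stdAddChar (j : ZMod k) := by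
  rw [ZMod.stdAddChar_coe, xi, ← Complex.exp_int_mul]
  congr 1
  ring

lemma coeff_matAct_lensGen [NeZero k] (s : Fin n → ℤ) (P : Rn n) (m : Fin n ⊕ Fin n →₀ ℕ) :
    coeff m (matAct n (lensGen n k s) P) =
      ZMod.stdAddChar (-∑ i, (s i : ZMod k) *
        ((m (Sum.inl i) : ZMod k) - (m (Sum.inr i) : ZMod k))) * coeff m P := by
  rw [lensGen, coeff_matAct_diagonal fun i => zpow_ne_zero _ (xi_ne_zero k),
    ← Finset.sum_neg_distrib, stdAddChar_sum]
  congr 1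
  refine Finset.prod_congr rfl fun i _ => ?_
  rw [map_inv₀, map_zpow₀, star_xi, _root_.inv_zpow, inv_inv, ← _root_.zpow_neg, xi_zpow, xi_zpow,
    ← AddChar.map_nsmul_eq_pow, ← AddChar.map_nsmul_eq_pow, ← AddChar.map_add_eq_mul]
  congr 1
  push_cast
  rw [nsmul_eq_mul, nsmul_eq_mul]
  ring

lemma exists_eq_lensGen_of_mem {s : Fin n → ℤ} {γ : Matrix.unitaryGroup (Fin n) ℂ}
    (hγ : γ ∈ lensSubgroup n k s) :
    ∃ j : ℤ, (γ : Matrix (Fin n) (Fin n) ℂ) = lensGen n k fun i => j * s i := by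
  let f : Multiplicative ℤ →* Matrix.unitaryGroup (Fin n) ℂ :=
    MonoidHom.mk'
      (fun j : Multiplicative ℤ => ⟨lensGen n k fun i => j.toAdd * s i, lensGen_mem n k _⟩) fun a b => by
      refine Subtype.ext ?_
      simp [lensGen, diagonal_mul_diagonal, add_mul, zpow_add₀ (xi_ne_zero k)]
  obtain ⟨j, rfl⟩ := Subgroup.mem_zpowers_iff.1 hγ
  refine ⟨j, ?_⟩
  have h := MonoidHom.apply_mint _ f (Multiplicative.ofAdd j)
  have h1 : f (Multiplicative.ofAdd 1) = ⟨lensGen n k s, lensGen_mem n k s⟩ := by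
    refine Subtype.ext ?_
    simp [f]
  rw [h1] at h
  exact congrArg Subtype.val h.symm

lemma mem_fixedBy_iff (γ : Matrix (Fin n) (Fin n) ℂ) (P : Rn n) :
    P ∈ fixedBy n γ ↔ matAct n γ P = P := by
  simp [fixedBy, sub_eq_zero]

lemma HpqInv_lensSubgroup [NeZero k] (s : Fin n → ℤ) (p q : ℕ) :
    HpqInv n p q (lensSubgroup n k s) =
      restrictSupport ℂ (balancedExponents (fun i => (s i : ZMod k)) p q) ⊓
        LinearMap.ker (DeltaOp n) := by
  rw [HpqInv, Hpq, inf_right_comm]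
  congr 1
  ext P
  rw [Submodule.mem_inf, mem_restrictSupport_iff, Ppq, mem_weightedHomogeneousSubmodule]
  simp only [Submodule.mem_iInf, mem_fixedBy_iff]
  constructor
  · rintro ⟨hhom, hfix⟩ m hm
    have hcoeff := mem_support_iff.1 hm
    have hw := hhom hcoeff
    rw [weight_wt, Prod.mk.injEq] at hw
    refine ⟨hw.1, hw.2, ?_⟩
    have h := congrArg (coeff m) (hfix _ (Subgroup.mem_zpowers _))
    rw [coeff_matAct_lensGen] at h
    have h1 := mul_right_cancel₀ hcoeff (h.trans (one_mul _).symm)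
    rw [← AddChar.map_zero_eq_one (ZMod.stdAddChar (N := k))] at h1
    exact neg_eq_zero.1 (ZMod.injective_stdAddChar (N := k) h1)
  · intro h
    refine ⟨fun m hm => ?_, fun γ hγ => ?_⟩
    · obtain ⟨hl, hr, -⟩ := h (mem_support_iff.2 hm)
      rw [weight_wt, hl, hr]
    · obtain ⟨j, hj⟩ := exists_eq_lensGen_of_mem hγ
      ext m
      rw [hj, coeff_matAct_lensGen]
      by_cases hm : coeff m P = 0
      · simp [hm]
      · have hzero := (h (mem_support_iff.2 hm)).2.2
        simp only [Int.cast_mul, mul_assoc, ← Finset.mul_sum]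
        rw [hzero]
        simp

end Invariants

/-- **Ikeda-type family of mutually CR isospectral lens spaces.**
For an odd prime `k ≥ 5` and `n = k - 3`, any two lens spaces in the family `𝒢(k-3,k)`
have the same invariant dimensions `d_Γ(p,q)`, hence are CR isospectral. -/
theorem ikeda_family_CR_isospectral (k : ℕ) (hk : Nat.Prime k) (hodd : Odd k) (hk5 : 5 ≤ k)
    (s s' : Fin (k - 3) → ℤ)
    (hs1 : ∀ i, Int.gcd (s i) k = 1)
    (hs2 : ∀ i j, i ≠ j → ¬ ((k : ℤ) ∣ (s i - s j)))
    (hs3 : ∃ i, ∀ j, ¬ ((k : ℤ) ∣ (s i + s j)))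
    (hs'1 : ∀ i, Int.gcd (s' i) k = 1)
    (hs'2 : ∀ i j, i ≠ j → ¬ ((k : ℤ) ∣ (s' i - s' j)))
    (hs'3 : ∃ i, ∀ j, ¬ ((k : ℤ) ∣ (s' i + s' j))) :
    ∀ p q : ℕ, dInv (k - 3) p q (lensSubgroup (k - 3) k s)
      = dInv (k - 3) p q (lensSubgroup (k - 3) k s') := by
  intro p q
  have : Fact k.Prime := ⟨hk⟩
  have hn : 0 < k - 3 := by omega
  have hinj : ∀ r : Fin (k - 3) → ℤ, (∀ i j, i ≠ j → ¬ ((k : ℤ) ∣ (r i - r j))) →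
      Function.Injective fun i => (r i : ZMod k) := fun r hr i j hij => by
    by_contra hne
    refine hr i j hne ((ZMod.intCast_zmod_eq_zero_iff_dvd _ k).1 ?_)
    rw [Int.cast_sub]
    exact sub_eq_zero.2 hij
  have hne : ∀ r : Fin (k - 3) → ℤ, (∀ i, Int.gcd (r i) k = 1) → ∀ i, (r i : ZMod k) ≠ 0 :=
    fun r hr i h => by
      have hdvd := Int.dvd_gcd ((ZMod.intCast_zmod_eq_zero_iff_dvd _ k).1 h) dvd_rfl
      rw [hr i] at hdvd
      exact hk.one_lt.ne' (by exact Nat.dvd_one.1 hdvd)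
  have hneg : ∀ r : Fin (k - 3) → ℤ, (∃ i, ∀ j, ¬ ((k : ℤ) ∣ (r i + r j))) →
      ∃ i, ∀ j, (r i : ZMod k) + (r j : ZMod k) ≠ 0 := fun r ⟨i, hi⟩ =>
    ⟨i, fun j h => hi j ((ZMod.intCast_zmod_eq_zero_iff_dvd _ k).1 (by rw [Int.cast_add, h]))⟩
  have hcount := balancedCount_eq (by omega) (hinj s hs2) (hne s hs1) (hneg s hs3)
    (hinj s' hs'2) (hne s' hs'1) (hneg s' hs'3)
  rw [dInv, dInv, HpqInv_lensSubgroup, HpqInv_lensSubgroup]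
  by_cases hpq : p = 0 ∨ q = 0
  · rw [finrank_harmonic_of_eq_zero hpq, finrank_harmonic_of_eq_zero hpq, hcount]
  · obtain ⟨hp, hq⟩ := not_or.1 hpq
    obtain ⟨p, rfl⟩ := Nat.exists_eq_succ_of_ne_zero hp
    obtain ⟨q, rfl⟩ := Nat.exists_eq_succ_of_ne_zero hq
    refine Nat.add_right_cancel (m := balancedCount (fun i => (s i : ZMod k)) p q) ?_
    rw [finrank_harmonic_succ hn, hcount, hcount, finrank_harmonic_succ hn]

end
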